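/- arXiv:2201.05600 — 5 statements merged into one kernel-verified Lean document; each statement's English description precedes it below -/
import Mathlib

section
/- Assume in addition that σ < 2(b−1)(1−β) and b < 3/2. Then there exists α_0 > 0 (depending only on β, b, σ) such that for every α ∈ (0, α_0) there exists a_0 > 1 with the property: for all a ≥ a_0 and all q ∈ ℕ, λ_q ≤ ℓ_q^{-1} ≤ λ_{q+1} ≤ λ_q^{3/2}. -/
open Filter Topology

/-- `λ_q := ⌈a^(b^q)⌉`, as a real number. -/
noncomputable def lam (a b : ℝ) (q : ℕ) : ℝ := (⌈a ^ (b ^ q)⌉₊ : ℝ)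

/-- `δ_q := λ_q^(-2β)`. -/
noncomputable def del (a b β : ℝ) (q : ℕ) : ℝ := lam a b q ^ (-(2 * β))

/-- `ε_q := λ_q^(-σ)`. -/
noncomputable def eps (a b σ : ℝ) (q : ℕ) : ℝ := lam a b q ^ (-σ)

/-- `τ_q := δ_q^(-1/2) λ_q^(-1-3α)`. -/
noncomputable def tau (a b β α : ℝ) (q : ℕ) : ℝ :=
  del a b β q ^ (-(1/2 : ℝ)) * lam a b q ^ (-(1 + 3 * α))

/-- `ℓ_q := δ_{q+1}^(1/2) δ_q^(-1/2) λ_q^(-(1+σ/2+3α/2))`. -/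
noncomputable def ell (a b β σ α : ℝ) (q : ℕ) : ℝ :=
  del a b β (q + 1) ^ ((1/2 : ℝ)) * del a b β q ^ (-(1/2 : ℝ)) *
    lam a b q ^ (-(1 + σ/2 + 3 * α / 2))

theorem lam_pos {a b : ℝ} (ha : 1 < a) (q : ℕ) : 0 < lam a b q :=
  Nat.cast_pos.2 (Nat.ceil_pos.2 (by positivity))

theorem lam_le_lam_succ {a b : ℝ} (ha : 1 < a) (hb : 1 < b) (q : ℕ) :
    lam a b q ≤ lam a b (q + 1) :=
  Nat.cast_le.2 <| Nat.ceil_mono <|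
    Real.rpow_le_rpow_of_exponent_le ha.le (pow_le_pow_right₀ hb.le q.le_succ)

/-- `λ_q` agrees with `a^(b^q)` up to a factor `2`, on the logarithmic scale. -/
theorem log_lam_bounds {a b : ℝ} (ha : 1 < a) (hb : 1 < b) (q : ℕ) :
    b ^ q * Real.log a ≤ Real.log (lam a b q) ∧
      Real.log (lam a b q) ≤ b ^ q * Real.log a + Real.log 2 := by
  have h0 : 0 < a ^ (b ^ q) := by positivity
  have h1 : 1 ≤ a ^ (b ^ q) := Real.one_le_rpow ha.le (by positivity)
  rw [← Real.log_rpow (by linarith), ← Real.log_mul h0.ne' two_ne_zero]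
  refine ⟨Real.log_le_log h0 (Nat.le_ceil _), Real.log_le_log (lam_pos ha q) ?_⟩
  have := Nat.ceil_lt_add_one h0.le
  unfold lam
  linarith

theorem inv_ell_pos {a b β σ α : ℝ} {q : ℕ} (hx : 0 < lam a b q)
    (hy : 0 < lam a b (q + 1)) : 0 < (ell a b β σ α q)⁻¹ := by
  unfold ell del
  positivity

theorem log_inv_ell {a b β σ α : ℝ} {q : ℕ} (hx : 0 < lam a b q)
    (hy : 0 < lam a b (q + 1)) :
    Real.log (ell a b β σ α q)⁻¹ =
      β * (Real.log (lam a b (q + 1)) - Real.log (lam a b q)) +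
        (1 + (σ / 2 + 3 * α / 2)) * Real.log (lam a b q) := by
  unfold ell del
  rw [Real.log_inv, Real.log_mul (by positivity) (by positivity),
    Real.log_mul (by positivity) (by positivity), Real.log_rpow (by positivity),
    Real.log_rpow (by positivity), Real.log_rpow (by positivity),
    Real.log_rpow hx, Real.log_rpow hx]
  ring

/-- if `σ < 2(b-1)(1-β)` and `b < 3/2`, then for sufficiently small `α`
and sufficiently large `a`, `λ_q ≤ ℓ_q⁻¹ ≤ λ_{q+1} ≤ λ_q^{3/2}` for all `q`. -/
theorem stmt1 (β b σ : ℝ) (hβ : 0 < β) (hβ' : β < 1/3) (hb : 1 < b) (hσ : 0 < σ)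
    (hσ2 : σ < 2 * (b - 1) * (1 - β)) (hb2 : b < 3/2) :
    ∃ α0 : ℝ, 0 < α0 ∧ ∀ α : ℝ, 0 < α → α < α0 →
      ∃ a0 : ℝ, 1 < a0 ∧ ∀ a : ℝ, a0 ≤ a → ∀ q : ℕ,
        lam a b q ≤ (ell a b β σ α q)⁻¹ ∧
        (ell a b β σ α q)⁻¹ ≤ lam a b (q + 1) ∧
        lam a b (q + 1) ≤ lam a b q ^ ((3:ℝ)/2) := by
  set D : ℝ := (b - 1) * (1 - β) - σ / 2 with hD
  refine ⟨D / 3, by linarith, fun α hα hαD => ?_⟩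
  set s : ℝ := σ / 2 + 3 * α / 2 with hs
  have hs0 : 0 < s := by positivity
  have hκ : 0 < (b - 1) * (1 - β) - s := by linarith
  have hc : 0 < 1 - β + s := by linarith
  have hb3 : 0 < 3 / 2 - b := by linarith
  have hlog2 : 0 < Real.log 2 := Real.log_pos one_lt_two
  set A : ℝ := (1 - β + s) * Real.log 2 / ((b - 1) * (1 - β) - s) with hA
  set B : ℝ := Real.log 2 / (3 / 2 - b) with hB
  have hA0 : 0 < A := by positivity
  have hB0 : 0 < B := by positivity
  refine ⟨Real.exp (A + B), Real.one_lt_exp_iff.2 (by positivity), fun a ha q => ?_⟩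
  have ha1 : 1 < a := (Real.one_lt_exp_iff.2 (by positivity)).trans_le ha
  have hloga : A + B ≤ Real.log a := (Real.le_log_iff_exp_le (by linarith)).2 ha
  set L : ℝ := b ^ q * Real.log a with hL
  have hbq : 1 ≤ b ^ q := one_le_pow₀ hb.le
  have hAB : A + B ≤ L := hloga.trans (le_mul_of_one_le_left (by linarith) hbq)
  obtain ⟨hx1, hx2⟩ := log_lam_bounds ha1 hb q
  obtain ⟨hy1, hy2⟩ := log_lam_bounds ha1 hb (q + 1)
  have hL' : b ^ (q + 1) * Real.log a = b * L := by rw [hL, pow_succ]; ring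
  rw [hL'] at hy1 hy2
  rw [← hL] at hx1 hx2
  have hxy : Real.log (lam a b q) ≤ Real.log (lam a b (q + 1)) :=
    Real.log_le_log (lam_pos ha1 q) (lam_le_lam_succ ha1 hb q)
  have hx := lam_pos (b := b) ha1 q
  have hy := lam_pos (b := b) ha1 (q + 1)
  have hell := log_inv_ell (β := β) (σ := σ) (α := α) hx hy
  have hell0 := inv_ell_pos (β := β) (σ := σ) (α := α) hx hy
  have hLA : (1 - β + s) * Real.log 2 ≤ L * ((b - 1) * (1 - β) - s) :=
    (div_le_iff₀ hκ).1 (show A ≤ L by linarith)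
  have hLB : Real.log 2 ≤ L * (3 / 2 - b) := (div_le_iff₀ hb3).1 (show B ≤ L by linarith)
  refine ⟨(Real.log_le_log_iff hx hell0).1 ?_, (Real.log_le_log_iff hell0 hy).1 ?_,
    (Real.log_le_log_iff hy (by positivity)).1 ?_⟩
  · rw [hell, ← hs]
    have h1 := mul_nonneg hβ.le (sub_nonneg.2 hxy)
    have h2 : 0 ≤ s * Real.log (lam a b q) := mul_nonneg hs0.le (by linarith)
    linarith
  · rw [hell, ← hs]
    have h1 := mul_le_mul_of_nonneg_left hx2 hc.le
    have h2 := mul_le_mul_of_nonneg_left hy1 (show 0 ≤ 1 - β by linarith)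
    linarith
  · rw [Real.log_rpow hx]
    linarith
end

section
/- Assume in addition that 1 − β − 2bβ > 0 and σ < (b−1)(1−β−2bβ)/(b+1). Then there exists α_0 > 0 (depending only on β, b, σ) such that for every α ∈ (0, α_0) there exists a_0 > 1 with the property: for all a ≥ a_0 and all q ∈ ℕ, ε_q^{−1} δ_{q+1}^{1/2} δ_q^{1/2} λ_{q+1}^{−1+10α} λ_q^{1+10α} ≤ ε_{q+1} δ_{q+2} λ_{q+1}^{−4α}. -/
open Filter Topology

/-- For `a ≥ 1`, rounding up changes the logarithm of `a ^ (b ^ q)` by at most `log 2`. -/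
theorem exists_lam_eq_exp {a b : ℝ} (ha : 1 ≤ a) (hb : 0 ≤ b) (q : ℕ) :
    ∃ L : ℝ, lam a b q = Real.exp L ∧ b ^ q * Real.log a ≤ L ∧
      L ≤ b ^ q * Real.log a + Real.log 2 := by
  have ha0 : 0 < a := by linarith
  have hx : 1 ≤ a ^ (b ^ q) := Real.one_le_rpow ha (by positivity)
  have hx0 : 0 < a ^ (b ^ q) := by linarith
  have hle : a ^ (b ^ q) ≤ lam a b q := Nat.le_ceil _
  have hlt : lam a b q < a ^ (b ^ q) + 1 := Nat.ceil_lt_add_one hx0.le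
  have hl0 : 0 < lam a b q := by linarith
  refine ⟨Real.log (lam a b q), (Real.exp_log hl0).symm, ?_, ?_⟩
  · rw [← Real.log_rpow ha0]
    exact Real.log_le_log hx0 hle
  · rw [← Real.log_rpow ha0, ← Real.log_mul hx0.ne' two_ne_zero]
    exact Real.log_le_log hl0 (by linarith)

/-- if `1 - β - 2bβ > 0` and `σ < (b-1)(1-β-2bβ)/(b+1)`, then for
sufficiently small `α` and sufficiently large `a`,
`ε_q⁻¹ δ_{q+1}^{1/2} δ_q^{1/2} λ_{q+1}^{-1+10α} λ_q^{1+10α} ≤ ε_{q+1} δ_{q+2} λ_{q+1}^{-4α}`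
for all `q`. -/
theorem stmt5 (β b σ : ℝ) (hβ : 0 < β) (hβ' : β < 1/3) (hb : 1 < b) (hσ : 0 < σ)
    (h1 : 0 < 1 - β - 2 * b * β) (hσ2 : σ < (b - 1) * (1 - β - 2 * b * β) / (b + 1)) :
    ∃ α0 : ℝ, 0 < α0 ∧ ∀ α : ℝ, 0 < α → α < α0 →
      ∃ a0 : ℝ, 1 < a0 ∧ ∀ a : ℝ, a0 ≤ a → ∀ q : ℕ,
        (eps a b σ q)⁻¹ * del a b β (q + 1) ^ ((1:ℝ)/2) * del a b β q ^ ((1:ℝ)/2) *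
            lam a b (q + 1) ^ (-1 + 10 * α) * lam a b q ^ (1 + 10 * α)
          ≤ eps a b σ (q + 1) * del a b β (q + 2) * lam a b (q + 1) ^ (-(4 * α)) := by
  have hσ3 : σ * (b + 1) < (b - 1) * (1 - β - 2 * b * β) := (lt_div_iff₀ (by linarith)).mp hσ2
  refine ⟨((b - 1) * (1 - β - 2 * b * β) - σ * (b + 1)) / (10 + 14 * b),
    div_pos (by linarith) (by linarith), fun α hα hα' => ?_⟩
  have hα2 := (lt_div_iff₀ (by linarith)).mp hα'
  set g := (b - 1) * (1 - β - 2 * b * β) - σ * (b + 1) - α * (10 + 14 * b) with hg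
  have hg0 : 0 < g := by linarith
  set c := σ + 1 - β + 10 * α with hc
  have hc0 : 0 < c := by linarith
  have hlog2 : 0 < Real.log 2 := Real.log_pos one_lt_two
  refine ⟨Real.exp ((c + 2 * β) * Real.log 2 / g), Real.one_lt_exp_iff.mpr (by positivity),
    fun a ha q => ?_⟩
  have ha1 : 1 ≤ a := le_trans (Real.one_le_exp (by positivity)) ha
  have hloga := (Real.le_log_iff_exp_le (by linarith)).mpr ha
  rw [div_le_iff₀ hg0] at hloga
  obtain ⟨L₀, e₀, -, u₀⟩ := exists_lam_eq_exp ha1 (by linarith : 0 ≤ b) q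
  obtain ⟨L₁, e₁, l₁, -⟩ := exists_lam_eq_exp ha1 (by linarith : 0 ≤ b) (q + 1)
  obtain ⟨L₂, e₂, -, u₂⟩ := exists_lam_eq_exp ha1 (by linarith : 0 ≤ b) (q + 2)
  simp only [eps, del, e₀, e₁, e₂, ← Real.exp_mul, ← Real.exp_neg, ← Real.exp_add]
  rw [Real.exp_le_exp]
  have ht : Real.log a ≤ b ^ q * Real.log a :=
    le_mul_of_one_le_left (Real.log_nonneg ha1) (one_le_pow₀ hb.le)
  rw [pow_succ] at l₁
  rw [pow_add] at u₂
  set t := b ^ q * Real.log a with htdef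
  have l₁' : b * t ≤ L₁ := by linarith
  have u₂' : L₂ ≤ b ^ 2 * t + Real.log 2 := by linarith
  set d := 1 + β - σ - 14 * α with hd
  have hbd : b * d = g + c + 2 * β * b ^ 2 := by rw [hg, hc, hd]; ring
  have hd0 : 0 ≤ d := by
    have : 0 < b * d := by rw [hbd]; positivity
    exact (pos_of_mul_pos_right this (by linarith)).le
  have k₀ := mul_le_mul_of_nonneg_left u₀ hc0.le
  have k₁ := mul_le_mul_of_nonneg_left l₁' hd0
  have k₂ := mul_le_mul_of_nonneg_left u₂' (by linarith : 0 ≤ 2 * β)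
  have k₃ := mul_le_mul_of_nonneg_right ht hg0.le
  have k₄ : d * (b * t) = g * t + c * t + 2 * β * b ^ 2 * t := by
    rw [← mul_assoc, mul_comm d, hbd]; ring
  have key : c * L₀ + 2 * β * L₂ ≤ d * L₁ := by linarith
  rw [hc, hd] at key
  linarith
end

section
/- Fix C ≥ 1 and suppose that for every integer q ≥ 1, B_q ⊆ ℝ is a union of at most C · τ_q^{−1} · ∏_{i=1}^{q−1} ε_i closed intervals, each of length at most C · ε_q · τ_q. Then the Hausdorff dimension of the intersection ⋂_{q≥1} B_q is at most 1 − σb / ((b−1)(1 + 3α + σ − β)). -/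
open Filter Topology

open MeasureTheory in
/-- A set which, at scales `r q → 0`, is covered by `n q` sets of diameter at most `r q`, with
`n q * r q ^ d` bounded, has Hausdorff dimension at most `d`. -/
theorem dimH_le_of_card_mul_rpow_le {X : Type*} [EMetricSpace X] {s : Set X} {d : NNReal}
    {r : ℕ → ℝ} (hr0 : ∀ q, 0 ≤ r q) (hr : Tendsto r atTop (𝓝 0)) {n : ℕ → ℕ}
    {t : ∀ q, Fin (n q) → Set X} (hst : ∀ q, s ⊆ ⋃ i, t q i)
    (ht : ∀ q i, Metric.ediam (t q i) ≤ ENNReal.ofReal (r q)) {K : ℝ}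
    (hK : ∀ q, n q * r q ^ (d : ℝ) ≤ K) : dimH s ≤ d := by
  borelize X
  refine dimH_le_of_hausdorffMeasure_ne_top
    (ne_top_of_le_ne_top (ENNReal.ofReal_ne_top (r := K)) ?_)
  have hr' : Tendsto (fun q => ENNReal.ofReal (r q)) atTop (𝓝 0) := by
    simpa using ENNReal.tendsto_ofReal hr
  refine (Measure.hausdorffMeasure_le_liminf_sum d s _ hr' t (Eventually.of_forall ht)
    (Eventually.of_forall hst)).trans ?_
  refine (liminf_le_liminf (v := fun _ => ENNReal.ofReal K)
    (Eventually.of_forall fun q => ?_)).trans_eq (liminf_const _)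
  calc ∑ i, Metric.ediam (t q i) ^ (d : ℝ)
      ≤ ∑ _i : Fin (n q), ENNReal.ofReal (r q ^ (d : ℝ)) := by
        refine Finset.sum_le_sum fun i _ => ?_
        rw [← ENNReal.ofReal_rpow_of_nonneg (hr0 q) d.coe_nonneg]
        exact ENNReal.rpow_le_rpow (ht q i) d.coe_nonneg
    _ = ENNReal.ofReal (n q * r q ^ (d : ℝ)) := by
        rw [ENNReal.ofReal_mul (Nat.cast_nonneg _)]
        simp
    _ ≤ ENNReal.ofReal K := ENNReal.ofReal_le_ofReal (hK q)

theorem rpow_pow_le_lam (a b : ℝ) (q : ℕ) : a ^ (b ^ q) ≤ lam a b q := Nat.le_ceil _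

theorem one_le_rpow_pow {a b : ℝ} (ha : 1 < a) (hb : 1 < b) (q : ℕ) : 1 ≤ a ^ (b ^ q) :=
  Real.one_le_rpow ha.le (by positivity)

theorem one_le_lam {a b : ℝ} (ha : 1 < a) (hb : 1 < b) (q : ℕ) : 1 ≤ lam a b q :=
  (one_le_rpow_pow ha hb q).trans (rpow_pow_le_lam a b q)

theorem lam_le_two_mul {a b : ℝ} (ha : 1 < a) (hb : 1 < b) (q : ℕ) :
    lam a b q ≤ 2 * a ^ (b ^ q) := by
  have h := one_le_rpow_pow ha hb q
  have := Nat.ceil_lt_add_one (zero_le_one.trans h)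
  unfold lam
  linarith

theorem tendsto_lam_atTop {a b : ℝ} (ha : 1 < a) (hb : 1 < b) :
    Tendsto (lam a b) atTop atTop :=
  tendsto_atTop_mono (rpow_pow_le_lam a b)
    ((tendsto_rpow_atTop_of_base_gt_one a ha).comp (tendsto_pow_atTop_atTop_of_one_lt hb))

theorem tau_eq {a b : ℝ} (ha : 1 < a) (hb : 1 < b) (β α : ℝ) (q : ℕ) :
    tau a b β α q = lam a b q ^ (-(1 + 3 * α - β)) := by
  have h : 0 < lam a b q := one_pos.trans_le (one_le_lam ha hb q)
  rw [tau, del, ← Real.rpow_mul h.le, ← Real.rpow_add h]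
  congr 1
  ring

theorem prod_eps_le {a b σ : ℝ} (ha : 1 < a) (hb : 1 < b) (hσ : 0 < σ) (q : ℕ) :
    ∏ i ∈ Finset.Icc 1 q, eps a b σ i ≤ a ^ (σ / (b - 1) * (b - b ^ (q + 1))) := by
  have ha0 : 0 < a := one_pos.trans ha
  have hb1 : b - 1 ≠ 0 := (sub_pos.2 hb).ne'
  induction q with
  | zero => simp
  | succ q ih =>
    rw [Finset.prod_Icc_succ_top (by omega)]
    have h : eps a b σ (q + 1) ≤ a ^ (-σ * b ^ (q + 1)) := by
      rw [mul_comm, Real.rpow_mul ha0.le]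
      exact Real.rpow_le_rpow_of_nonpos (by positivity) (rpow_pow_le_lam a b _) (by linarith)
    have h0 : 0 ≤ eps a b σ (q + 1) :=
      Real.rpow_nonneg (zero_le_one.trans (one_le_lam ha hb _)) _
    refine (mul_le_mul ih h h0 (by positivity)).trans_eq ?_
    rw [← Real.rpow_add ha0]
    congr 1
    field_simp
    ring

/-- The critical exponent bound: `τ⁻¹ (∏ ε_i) (ε τ)^d` stays bounded. -/
theorem rpow_mul_prod_eps_le {a b σ κ d : ℝ} (ha : 1 < a) (hb : 1 < b) (hσ : 0 < σ)
    (hd : κ - d * (κ + σ) ≤ σ / (b - 1)) (q : ℕ) :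
    lam a b (q + 1) ^ (κ - d * (κ + σ)) * ∏ i ∈ Finset.Icc 1 q, eps a b σ i ≤
      2 ^ (σ / (b - 1)) * a ^ (σ / (b - 1) * b) := by
  have ha0 : 0 < a := one_pos.trans ha
  have hs : 0 ≤ σ / (b - 1) := div_nonneg hσ.le (sub_pos.2 hb).le
  have hl := one_le_lam ha hb (q + 1)
  have h1 : lam a b (q + 1) ^ (κ - d * (κ + σ)) ≤
      2 ^ (σ / (b - 1)) * a ^ (b ^ (q + 1) * (σ / (b - 1))) := by
    rw [Real.rpow_mul ha0.le, ← Real.mul_rpow (by norm_num) (by positivity)]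
    exact (Real.rpow_le_rpow_of_exponent_le hl hd).trans
      (Real.rpow_le_rpow (zero_le_one.trans hl) (lam_le_two_mul ha hb _) hs)
  have h0 : 0 ≤ ∏ i ∈ Finset.Icc 1 q, eps a b σ i := Finset.prod_nonneg fun i _ =>
    Real.rpow_nonneg (zero_le_one.trans (one_le_lam ha hb i)) _
  refine (mul_le_mul h1 (prod_eps_le ha hb hσ q) h0 (by positivity)).trans_eq ?_
  rw [mul_assoc, ← Real.rpow_add ha0]
  ring_nf

/-- if for every `q ≥ 1` the set `B_q ⊆ ℝ` is a union of at most
`C τ_q⁻¹ ∏_{i=1}^{q-1} ε_i` closed intervals, each of length at most `C ε_q τ_q`,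
then the Hausdorff dimension of `⋂_{q ≥ 1} B_q` is at most
`1 - σb/((b-1)(1+3α+σ-β))`. -/
theorem stmt9 (β b σ α a : ℝ) (hβ : 0 < β) (hβ' : β < 1/3) (hb : 1 < b) (hσ : 0 < σ)
    (hα : 0 < α) (ha : 1 < a) (C : ℝ) (hC : 1 ≤ C) (B : ℕ → Set ℝ)
    (hB : ∀ q : ℕ, 1 ≤ q → ∃ (n : ℕ) (I : Fin n → Set ℝ),
      (n : ℝ) ≤ C * (tau a b β α q)⁻¹ * ∏ i ∈ Finset.Icc 1 (q - 1), eps a b σ i ∧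
      B q = ⋃ i, I i ∧
      ∀ i, ∃ x y : ℝ, I i = Set.Icc x y ∧ y - x ≤ C * eps a b σ q * tau a b β α q) :
    dimH (⋂ (q : ℕ) (_ : 1 ≤ q), B q) ≤
      ENNReal.ofReal (1 - σ * b / ((b - 1) * (1 + 3 * α + σ - β))) := by
  have hκ : 0 < 1 + 3 * α - β := by linarith
  set κ := 1 + 3 * α - β with hκ_def
  have hκσ : 0 < κ + σ := by linarith
  have hb1 : 0 < b - 1 := sub_pos.2 hb
  have hl : ∀ q, 0 < lam a b q := fun q => one_pos.trans_le (one_le_lam ha hb q)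
  have hC0 : 0 < C := one_pos.trans_le hC
  have hlen : ∀ q, C * eps a b σ q * tau a b β α q = C * lam a b q ^ (-(κ + σ)) := fun q => by
    rw [tau_eq ha hb, eps, mul_assoc, ← Real.rpow_add (hl q)]
    congr 2
    ring
  set D := 1 - σ * b / ((b - 1) * (1 + 3 * α + σ - β)) with hD
  have hD' : D * (κ + σ) = κ - σ / (b - 1) := by
    have : 1 + 3 * α + σ - β = κ + σ := by rw [hκ_def]; ring
    rw [hD, this]
    field_simp
    ring
  have hd : κ - (D.toNNReal : ℝ) * (κ + σ) ≤ σ / (b - 1) := by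
    have := mul_le_mul_of_nonneg_right (Real.le_coe_toNNReal D) hκσ.le
    linarith
  choose n I hn hBI hI using fun q : ℕ => hB (q + 1) (Nat.le_add_left 1 q)
  refine dimH_le_of_card_mul_rpow_le (r := fun q => C * lam a b (q + 1) ^ (-(κ + σ)))
    (t := I) (K := C * C ^ (D.toNNReal : ℝ) * (2 ^ (σ / (b - 1)) * a ^ (σ / (b - 1) * b)))
    (fun q => mul_nonneg hC0.le (Real.rpow_nonneg (hl _).le _)) ?_ (fun q => ?_)
    (fun q i => ?_) fun q => ?_
  · simpa using ((tendsto_rpow_neg_atTop hκσ).comp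
      ((tendsto_lam_atTop ha hb).comp (tendsto_add_atTop_nat 1))).const_mul C
  · rw [← hBI q]
    exact Set.iInter₂_subset (q + 1) (Nat.le_add_left 1 q)
  · obtain ⟨x, y, h, hxy⟩ := hI q i
    rw [h, Real.ediam_Icc, ← hlen]
    exact ENNReal.ofReal_le_ofReal hxy
  · have hn' := hn q
    rw [tau_eq ha hb, ← hκ_def, Real.rpow_neg (hl _).le, inv_inv, Nat.add_sub_cancel] at hn'
    have hr : 0 ≤ (C * lam a b (q + 1) ^ (-(κ + σ))) ^ (D.toNNReal : ℝ) :=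
      Real.rpow_nonneg (mul_nonneg hC0.le (Real.rpow_nonneg (hl _).le _)) _
    refine (mul_le_mul_of_nonneg_right hn' hr).trans ?_
    have hsplit : lam a b (q + 1) ^ (κ - (D.toNNReal : ℝ) * (κ + σ)) =
        lam a b (q + 1) ^ κ * lam a b (q + 1) ^ (-(κ + σ) * (D.toNNReal : ℝ)) := by
      rw [← Real.rpow_add (hl _)]
      congr 1
      ring
    have key := mul_le_mul_of_nonneg_left (rpow_mul_prod_eps_le ha hb hσ hd q)
      (by positivity : 0 ≤ C * C ^ (D.toNNReal : ℝ))
    refine le_trans (le_of_eq ?_) key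
    rw [hsplit, Real.mul_rpow hC0.le (Real.rpow_nonneg (hl _).le _), ← Real.rpow_mul (hl _).le]
    ring
end

section
/- Let d ≥ 2, let k ∈ ℤ^d with k ≠ 0, and let a ∈ ℂ^d satisfy ∑_{j=1}^d k_j a_j = 0. Define the matrix-valued function T : ℝ^d → ℂ^{d×d} by T_{jm}(x) := ((k_j a_m − a_j k_m) / (2πi |k|²)) · e^{2πi⟨k,x⟩}, where ⟨k,x⟩ = ∑_j k_j x_j and |k|² = ∑_j k_j². Then for every x ∈ ℝ^d and every index m, ∑_{j=1}^d ∂_j T_{jm}(x) = a_m e^{2πi⟨k,x⟩}. Moreover, the resulting vector field x ↦ (a_m e^{2πi⟨k,x⟩})_m is divergence-free: ∑_{m=1}^d ∂_m ( a_m e^{2πi⟨k,x⟩} ) = 0. -/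
open Real

/-- The `j`-th partial derivative of a multiple of a plane wave `y ↦ c e^{s⟨w,y⟩}`. -/
theorem fderiv_const_mul_cexp_sum_single {ι : Type*} [Fintype ι] [DecidableEq ι] (w : ι → ℂ)
    (s c : ℂ) (x : ι → ℝ) (j : ι) :
    fderiv ℝ (fun y : ι → ℝ => c * Complex.exp (s * ∑ l, w l * (y l : ℂ))) x (Pi.single j 1)
      = c * (s * w j) * Complex.exp (s * ∑ l, w l * (x l : ℂ)) := by
  have hcoord (l : ι) : HasFDerivAt (fun y : ι → ℝ => (y l : ℂ))
      (Complex.ofRealCLM.comp (ContinuousLinearMap.proj (R := ℝ) l)) x :=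
    Complex.ofRealCLM.hasFDerivAt.comp x (hasFDerivAt_apply l x)
  have hsum := HasFDerivAt.fun_sum (u := Finset.univ) fun l _ => (hcoord l).const_mul (w l)
  rw [((hsum.const_mul s).cexp.const_mul c).fderiv]
  have hval : ∑ l, w l * ((Pi.single j (1 : ℝ) : ι → ℝ) l : ℂ) = w j := by
    simp [Pi.single_apply, apply_ite Complex.ofReal]
  simp [hval]
  ring

/-- for `k ∈ ℤ^d \ {0}` and `a ∈ ℂ^d` with `k · a = 0`, the matrix field
`T_{jm}(x) = ((k_j a_m - a_j k_m)/(2πi |k|²)) e^{2πi⟨k,x⟩}` satisfies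
`∑_j ∂_j T_{jm} = a_m e^{2πi⟨k,x⟩}`, and the vector field `x ↦ a e^{2πi⟨k,x⟩}` is
divergence-free. -/
theorem stmt14 (d : ℕ) (hd : 2 ≤ d) (k : Fin d → ℤ) (hk : k ≠ 0) (a : Fin d → ℂ)
    (ha : ∑ j, (k j : ℂ) * a j = 0) :
    (∀ x : Fin d → ℝ, ∀ m : Fin d,
      ∑ j, fderiv ℝ
          (fun y : Fin d → ℝ =>
            ((k j : ℂ) * a m - a j * (k m : ℂ)) /
                (2 * (π : ℂ) * Complex.I * ∑ l, ((k l : ℂ))^2) *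
              Complex.exp (2 * (π : ℂ) * Complex.I * ∑ l, (k l : ℂ) * (y l : ℂ)))
          x (Pi.single j 1)
        = a m * Complex.exp (2 * (π : ℂ) * Complex.I * ∑ l, (k l : ℂ) * (x l : ℂ))) ∧
    (∀ x : Fin d → ℝ,
      ∑ m, fderiv ℝ
          (fun y : Fin d → ℝ =>
            a m * Complex.exp (2 * (π : ℂ) * Complex.I * ∑ l, (k l : ℂ) * (y l : ℂ)))
          x (Pi.single m 1)
        = 0) := by
  constructor
  · intro x m
    have hnorm : ∑ l, (k l : ℂ) ^ 2 ≠ 0 := by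
      obtain ⟨i, hi⟩ := Function.ne_iff.mp hk
      have hpos : 0 < ∑ l, k l ^ 2 :=
        Finset.sum_pos' (fun l _ => sq_nonneg (k l))
          ⟨i, Finset.mem_univ i, sq_pos_of_ne_zero hi⟩
      exact_mod_cast hpos.ne'
    have hs : 2 * (π : ℂ) * Complex.I ≠ 0 := Complex.two_pi_I_ne_zero
    have hcontract : ∑ j, ((k j : ℂ) * a m - a j * (k m : ℂ)) * (k j : ℂ)
        = a m * ∑ l, (k l : ℂ) ^ 2 := by
      calc ∑ j, ((k j : ℂ) * a m - a j * (k m : ℂ)) * (k j : ℂ)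
          = a m * ∑ l, (k l : ℂ) ^ 2 - (k m : ℂ) * ∑ j, (k j : ℂ) * a j := by
            rw [Finset.mul_sum, Finset.mul_sum, ← Finset.sum_sub_distrib]
            exact Finset.sum_congr rfl fun j _ => by ring
        _ = a m * ∑ l, (k l : ℂ) ^ 2 := by rw [ha, mul_zero, sub_zero]
    simp_rw [fderiv_const_mul_cexp_sum_single]
    rw [← Finset.sum_mul]
    congr 1
    calc ∑ j, ((k j : ℂ) * a m - a j * (k m : ℂ)) /
            (2 * (π : ℂ) * Complex.I * ∑ l, (k l : ℂ) ^ 2) * (2 * (π : ℂ) * Complex.I * (k j : ℂ))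
        = (∑ j, ((k j : ℂ) * a m - a j * (k m : ℂ)) * (k j : ℂ)) / ∑ l, (k l : ℂ) ^ 2 := by
          rw [Finset.sum_div]
          exact Finset.sum_congr rfl fun j _ => by field_simp
      _ = a m := by rw [hcontract, mul_div_cancel_right₀ _ hnorm]
  · intro x
    simp_rw [fderiv_const_mul_cexp_sum_single]
    rw [← Finset.sum_mul]
    have hdot : ∑ m, a m * (2 * (π : ℂ) * Complex.I * (k m : ℂ)) = 0 := by
      calc ∑ m, a m * (2 * (π : ℂ) * Complex.I * (k m : ℂ))
          = 2 * (π : ℂ) * Complex.I * ∑ j, (k j : ℂ) * a j := by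
            rw [Finset.mul_sum]
            exact Finset.sum_congr rfl fun j _ => by ring
        _ = 0 := by rw [ha, mul_zero]
    rw [hdot, zero_mul]
end

section
/- Let d ≥ 1, let ψ : ℝ^d → ℝ be smooth, nonnegative, supported in the closed unit ball, with ∫_{ℝ^d} ψ = 1, and for ℓ > 0 set ψ_ℓ(x) := ℓ^{−d} ψ(x/ℓ). Let r ∈ [0,1]. Then there is a constant C (depending only on d, r, and ψ) such that for all bounded C¹ functions f, g : ℝ^d → ℝ with bounded first derivatives and all ℓ > 0, the commutator satisfies ‖(f∗ψ_ℓ)(g∗ψ_ℓ) − (fg)∗ψ_ℓ‖_{C^{0,r}} ≤ C ℓ^{2−r} ‖f‖_{C¹} ‖g‖_{C¹}, where ‖h‖_{C^{0,r}} := sup|h| + sup_{x≠y} |h(x)−h(y)|/|x−y|^r and ‖f‖_{C¹} := sup|f| + sup‖Df‖. -/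
/-- Convolution `(f ∗ h)(x) = ∫ f(x-y) h(y) dy` on `ℝ^d`. -/
noncomputable def mollConv (d : ℕ) (f h : EuclideanSpace ℝ (Fin d) → ℝ)
    (x : EuclideanSpace ℝ (Fin d)) : ℝ :=
  ∫ y, f (x - y) * h y

/-- The rescaled mollifier `ψ_ℓ(x) = ℓ^{-d} ψ(x/ℓ)`. -/
noncomputable def moll (d : ℕ) (ψ : EuclideanSpace ℝ (Fin d) → ℝ) (ℓ : ℝ)
    (x : EuclideanSpace ℝ (Fin d)) : ℝ :=
  (ℓ ^ d)⁻¹ * ψ (ℓ⁻¹ • x)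

section Covariance

open MeasureTheory

variable {E : Type*} [NormedAddCommGroup E] [MeasurableSpace E] [BorelSpace E]
  {μ : Measure E} [IsFiniteMeasureOnCompacts μ] {w A B A' B' : E → ℝ}

lemma integrable_mul_of_hasCompactSupport (hw : Continuous w) (hwc : HasCompactSupport w)
    (hA : Continuous A) : Integrable (fun y => A y * w y) μ :=
  (hA.mul hw).integrable_of_hasCompactSupport hwc.mul_left

lemma abs_integral_mul_le_of_abs_le (hw : Continuous w) (hwc : HasCompactSupport w)
    (hw0 : ∀ y, 0 ≤ w y) (hw1 : ∫ y, w y ∂μ = 1) (hA : Continuous A) {a : ℝ}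
    (ha : ∀ y, w y ≠ 0 → |A y| ≤ a) : |∫ y, A y * w y ∂μ| ≤ a := by
  calc |∫ y, A y * w y ∂μ| ≤ ∫ y, |A y * w y| ∂μ := abs_integral_le_integral_abs
    _ ≤ ∫ y, a * w y ∂μ := by
        refine integral_mono (integrable_mul_of_hasCompactSupport hw hwc hA).abs
          (integrable_mul_of_hasCompactSupport hw hwc continuous_const) fun y => ?_
        by_cases h : w y = 0
        · simp [h]
        · simpa only [abs_mul, abs_of_nonneg (hw0 y)] using
            mul_le_mul_of_nonneg_right (ha y h) (hw0 y)
    _ = a := by rw [integral_const_mul, hw1, mul_one]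

/-- The negative of the covariance of `A` and `B` under the density `w`. -/
noncomputable def negCov (μ : Measure E) (w A B : E → ℝ) : ℝ :=
  (∫ y, A y * w y ∂μ) * (∫ y, B y * w y ∂μ) - ∫ y, A y * B y * w y ∂μ

lemma negCov_sub_const (hw : Continuous w) (hwc : HasCompactSupport w)
    (hw1 : ∫ y, w y ∂μ = 1) (hA : Continuous A) (hB : Continuous B) (c e : ℝ) :
    negCov μ w (fun y => A y - c) (fun y => B y - e) = negCov μ w A B := by
  have int {F : E → ℝ} (hF : Continuous F) : Integrable (fun y => F y * w y) μ :=
    integrable_mul_of_hasCompactSupport hw hwc hF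
  have int_mul {F G : E → ℝ} (hF : Continuous F) (hG : Continuous G) :
      Integrable (fun y => F y * G y * w y) μ := int (hF.mul hG)
  have shift {F : E → ℝ} (hF : Continuous F) (k : ℝ) :
      ∫ y, (F y - k) * w y ∂μ = (∫ y, F y * w y ∂μ) - k := by
    simp_rw [sub_mul]
    rw [integral_sub (int hF) (int continuous_const), integral_const_mul, hw1, mul_one]
  have prod : ∫ y, (A y - c) * (B y - e) * w y ∂μ =
      (∫ y, A y * B y * w y ∂μ) - e * (∫ y, A y * w y ∂μ)
        - c * ((∫ y, B y * w y ∂μ) - e) := by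
    rw [← shift hB e, ← integral_const_mul, ← integral_const_mul,
      ← integral_sub (int_mul hA hB) ((int hA).const_mul e), ← integral_sub]
    · exact integral_congr_ae (.of_forall fun y => by ring)
    · exact (int_mul hA hB).sub ((int hA).const_mul e)
    · exact (int (hB.sub continuous_const)).const_mul c
  simp only [negCov]
  rw [prod, shift hA, shift hB]
  ring

lemma negCov_sub_negCov (hw : Continuous w) (hwc : HasCompactSupport w)
    (hA : Continuous A) (hB : Continuous B) (hA' : Continuous A') (hB' : Continuous B') :
    negCov μ w A B - negCov μ w A' B' =
      negCov μ w (fun y => A y - A' y) B + negCov μ w A' (fun y => B y - B' y) := by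
  have int {F : E → ℝ} (hF : Continuous F) : Integrable (fun y => F y * w y) μ :=
    integrable_mul_of_hasCompactSupport hw hwc hF
  have int_mul {F G : E → ℝ} (hF : Continuous F) (hG : Continuous G) :
      Integrable (fun y => F y * G y * w y) μ := int (hF.mul hG)
  simp only [negCov, sub_mul, mul_sub]
  rw [integral_sub (int hA) (int hA'), integral_sub (int hB) (int hB'),
    integral_sub (int_mul hA hB) (int_mul hA' hB),
    integral_sub (int_mul hA' hB) (int_mul hA' hB')]
  ring

lemma abs_negCov_le (hw : Continuous w) (hwc : HasCompactSupport w)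
    (hw0 : ∀ y, 0 ≤ w y) (hw1 : ∫ y, w y ∂μ = 1) (hA : Continuous A) (hB : Continuous B)
    (c e : ℝ) {a b : ℝ} (ha0 : 0 ≤ a) (ha : ∀ y, w y ≠ 0 → |A y - c| ≤ a)
    (hb : ∀ y, w y ≠ 0 → |B y - e| ≤ b) : |negCov μ w A B| ≤ 2 * (a * b) := by
  have hA' : Continuous fun y => A y - c := hA.sub continuous_const
  have hB' : Continuous fun y => B y - e := hB.sub continuous_const
  rw [← negCov_sub_const hw hwc hw1 hA hB c e, negCov]
  have h1 := abs_integral_mul_le_of_abs_le hw hwc hw0 hw1 hA' ha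
  have h2 := abs_integral_mul_le_of_abs_le hw hwc hw0 hw1 hB' hb
  have h3 := abs_integral_mul_le_of_abs_le hw hwc hw0 hw1 (A := fun y => (A y - c) * (B y - e))
    (a := a * b) (hA'.mul hB')
    fun y hy => by
      rw [abs_mul]
      exact mul_le_mul (ha y hy) (hb y hy) (abs_nonneg _) ha0
  refine (abs_sub _ _).trans ?_
  rw [abs_mul]
  linarith [mul_le_mul h1 h2 (abs_nonneg _) ha0]

end Covariance

section Mollifier

variable {d : ℕ} {ψ : EuclideanSpace ℝ (Fin d) → ℝ} {ℓ : ℝ}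

lemma continuous_moll (hψ : Continuous ψ) : Continuous (moll d ψ ℓ) :=
  continuous_const.mul (hψ.comp (continuous_const_smul _))

lemma norm_le_of_moll_ne_zero (hψ : Function.support ψ ⊆ Metric.closedBall 0 1) (hℓ : 0 < ℓ)
    {y : EuclideanSpace ℝ (Fin d)} (hy : moll d ψ ℓ y ≠ 0) : ‖y‖ ≤ ℓ := by
  have h := hψ (Function.mem_support.2 (right_ne_zero_of_mul hy))
  rw [mem_closedBall_zero_iff, norm_smul, norm_inv, Real.norm_of_nonneg hℓ.le,
    inv_mul_le_iff₀ hℓ, mul_one] at h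
  exact h

lemma hasCompactSupport_moll (hψ : Function.support ψ ⊆ Metric.closedBall 0 1) (hℓ : 0 < ℓ) :
    HasCompactSupport (moll d ψ ℓ) :=
  HasCompactSupport.of_support_subset_isCompact (isCompact_closedBall 0 ℓ) fun _ hy =>
    mem_closedBall_zero_iff.2 (norm_le_of_moll_ne_zero hψ hℓ hy)

lemma integral_moll (hψ : ∫ x, ψ x = 1) (hℓ : 0 < ℓ) : ∫ x, moll d ψ ℓ x = 1 := by
  simp only [moll]
  rw [MeasureTheory.integral_const_mul, MeasureTheory.Measure.integral_comp_inv_smul, hψ,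
    finrank_euclideanSpace_fin, abs_of_pos (pow_pos hℓ d), smul_eq_mul, mul_one,
    inv_mul_cancel₀ (pow_pos hℓ d).ne']

end Mollifier

lemma min_le_rpow_mul_rpow {a b r : ℝ} (ha : 0 ≤ a) (hb : 0 ≤ b) (hr0 : 0 ≤ r) (hr1 : r ≤ 1) :
    min a b ≤ a ^ (1 - r) * b ^ r := by
  have hm : 0 ≤ min a b := le_min ha hb
  calc min a b = min a b ^ (1 - r) * min a b ^ r := by
        rw [← Real.rpow_add_of_nonneg hm (sub_nonneg.2 hr1) hr0, sub_add_cancel, Real.rpow_one]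
    _ ≤ a ^ (1 - r) * b ^ r :=
        mul_le_mul (Real.rpow_le_rpow hm (min_le_left _ _) (sub_nonneg.2 hr1))
          (Real.rpow_le_rpow hm (min_le_right _ _) hr0) (Real.rpow_nonneg hm _)
          (Real.rpow_nonneg ha _)

lemma abs_sub_le_of_norm_fderiv_le {E : Type*} [NormedAddCommGroup E] [NormedSpace ℝ E]
    {f : E → ℝ} (hf : ContDiff ℝ 1 f) {M : ℝ} (hM : ∀ x, ‖fderiv ℝ f x‖ ≤ M) (x y : E) :
    |f x - f y| ≤ M * ‖x - y‖ :=
  convex_univ.norm_image_sub_le_of_norm_fderiv_le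
    (fun z _ => (hf.differentiable one_ne_zero) z) (fun z _ => hM z) trivial trivial

/-- commutator estimate for mollifications:
`‖(f∗ψ_ℓ)(g∗ψ_ℓ) - (fg)∗ψ_ℓ‖_{C^{0,r}} ≤ C ℓ^{2-r} ‖f‖_{C¹} ‖g‖_{C¹}`, expressed via
arbitrary bounds `Mf, Mg` on the `C¹` norms of `f, g`: both the sup norm and the
`r`-Hölder seminorm of the commutator are bounded by `C ℓ^{2-r} Mf Mg`. -/
theorem stmt19 (d : ℕ) (hd : 1 ≤ d) (ψ : EuclideanSpace ℝ (Fin d) → ℝ)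
    (hψ : ContDiff ℝ (⊤ : ℕ∞) ψ) (hψ0 : ∀ x, 0 ≤ ψ x)
    (hψsupp : Function.support ψ ⊆ Metric.closedBall 0 1)
    (hψint : ∫ x, ψ x = 1) (r : ℝ) (hr0 : 0 ≤ r) (hr1 : r ≤ 1) :
    ∃ C : ℝ, 0 < C ∧ ∀ f g : EuclideanSpace ℝ (Fin d) → ℝ,
      ContDiff ℝ 1 f → ContDiff ℝ 1 g →
      ∀ Mf Mg : ℝ,
        (∀ x, |f x| ≤ Mf) → (∀ x, ‖fderiv ℝ f x‖ ≤ Mf) →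
        (∀ x, |g x| ≤ Mg) → (∀ x, ‖fderiv ℝ g x‖ ≤ Mg) →
        ∀ ℓ : ℝ, 0 < ℓ →
          (∀ x, |mollConv d f (moll d ψ ℓ) x * mollConv d g (moll d ψ ℓ) x -
                  mollConv d (fun z => f z * g z) (moll d ψ ℓ) x|
              ≤ C * ℓ ^ ((2:ℝ) - r) * (Mf * Mg)) ∧
          (∀ x y, |(mollConv d f (moll d ψ ℓ) x * mollConv d g (moll d ψ ℓ) x -
                    mollConv d (fun z => f z * g z) (moll d ψ ℓ) x) -
                   (mollConv d f (moll d ψ ℓ) y * mollConv d g (moll d ψ ℓ) y -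
                    mollConv d (fun z => f z * g z) (moll d ψ ℓ) y)|
              ≤ C * ℓ ^ ((2:ℝ) - r) * (Mf * Mg) * ‖x - y‖ ^ r) := by
  refine ⟨4, by norm_num, fun f g hf hg Mf Mg hf0 hf1 hg0 hg1 ℓ hℓ => ?_⟩
  set w := moll d ψ ℓ with hw_def
  have hw : Continuous w := continuous_moll hψ.continuous
  have hwc : HasCompactSupport w := hasCompactSupport_moll hψsupp hℓ
  have hw0 : ∀ y, 0 ≤ w y := fun y => mul_nonneg (by positivity) (hψ0 _)
  have hw1 : ∫ y, w y = 1 := integral_moll hψint hℓ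
  have hMf : 0 ≤ Mf := (abs_nonneg _).trans (hf0 0)
  have hMg : 0 ≤ Mg := (abs_nonneg _).trans (hg0 0)
  have hM : 0 ≤ Mf * Mg := mul_nonneg hMf hMg
  have cont {h : EuclideanSpace ℝ (Fin d) → ℝ} (hh : ContDiff ℝ 1 h) (x) :
      Continuous fun y => h (x - y) := hh.continuous.comp (continuous_const.sub continuous_id)
  have osc {h : EuclideanSpace ℝ (Fin d) → ℝ} {M : ℝ} (hh : ContDiff ℝ 1 h) (hM : 0 ≤ M)
      (hh1 : ∀ x, ‖fderiv ℝ h x‖ ≤ M) (x y) (hy : w y ≠ 0) : |h (x - y) - h x| ≤ M * ℓ := by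
    refine (abs_sub_le_of_norm_fderiv_le hh hh1 _ _).trans ?_
    rw [sub_sub_cancel_left, norm_neg]
    exact mul_le_mul_of_nonneg_left (norm_le_of_moll_ne_zero hψsupp hℓ hy) hM
  have lip {h : EuclideanSpace ℝ (Fin d) → ℝ} {M : ℝ} (hh : ContDiff ℝ 1 h)
      (hh1 : ∀ x, ‖fderiv ℝ h x‖ ≤ M) (x z y) :
      |h (x - y) - h (z - y) - 0| ≤ M * ‖x - z‖ := by
    simpa using abs_sub_le_of_norm_fderiv_le hh hh1 (x - y) (z - y)
  let T := fun x => negCov MeasureTheory.volume w (fun y => f (x - y)) (fun y => g (x - y))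
  have hT_small (x) : |T x| ≤ 2 * (Mf * ℓ * (Mg * ℓ)) :=
    abs_negCov_le hw hwc hw0 hw1 (cont hf x) (cont hg x) (f x) (g x) (by positivity)
      (osc hf hMf hf1 x) (osc hg hMg hg1 x)
  have hT_bdd (x) : |T x| ≤ 2 * (Mf * Mg) :=
    abs_negCov_le hw hwc hw0 hw1 (cont hf x) (cont hg x) 0 0 hMf
      (fun y _ => by simpa using hf0 (x - y)) (fun y _ => by simpa using hg0 (x - y))
  have hT_lip (x z) : |T x - T z| ≤ 4 * (Mf * Mg) * ℓ * ‖x - z‖ := by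
    simp only [T]
    rw [negCov_sub_negCov hw hwc (cont hf x) (cont hg x) (cont hf z) (cont hg z)]
    have h1 := abs_negCov_le (μ := MeasureTheory.volume) hw hwc hw0 hw1
      ((cont hf x).sub (cont hf z)) (cont hg x) 0 (g x) (by positivity)
      (fun y _ => lip hf hf1 x z y) (osc hg hMg hg1 x)
    have h2 := abs_negCov_le (μ := MeasureTheory.volume) hw hwc hw0 hw1
      (cont hf z) ((cont hg x).sub (cont hg z)) (f z) 0 (by positivity)
      (osc hf hMf hf1 z) (fun y _ => lip hg hg1 x z y)
    refine (abs_add_le _ _).trans ((add_le_add h1 h2).trans_eq ?_)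
    ring
  refine ⟨fun x => ?_, fun x y => ?_⟩
  · change |T x| ≤ _
    rcases le_total ℓ 1 with h | h
    · have hp : ℓ ^ (2 : ℕ) ≤ ℓ ^ ((2 : ℝ) - r) := by
        rw [← Real.rpow_natCast]
        exact Real.rpow_le_rpow_of_exponent_ge hℓ h (by push_cast; linarith)
      nlinarith [hT_small x, mul_le_mul_of_nonneg_right hp hM, mul_nonneg hM (sq_nonneg ℓ)]
    · have hp : 1 ≤ ℓ ^ ((2 : ℝ) - r) := Real.one_le_rpow h (by linarith)
      nlinarith [hT_bdd x, mul_le_mul_of_nonneg_right hp hM]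
  · change |T x - T y| ≤ _
    have hK : 0 ≤ 4 * (Mf * Mg) * ℓ := by positivity
    calc |T x - T y| ≤ 4 * (Mf * Mg) * ℓ * min ℓ ‖x - y‖ := by
          rw [mul_min_of_nonneg _ _ hK]
          refine le_min ((abs_sub _ _).trans ?_) (hT_lip x y)
          linarith [hT_small x, hT_small y]
      _ ≤ 4 * (Mf * Mg) * ℓ * (ℓ ^ (1 - r) * ‖x - y‖ ^ r) :=
          mul_le_mul_of_nonneg_left (min_le_rpow_mul_rpow hℓ.le (norm_nonneg _) hr0 hr1) hK
      _ = 4 * ℓ ^ ((2 : ℝ) - r) * (Mf * Mg) * ‖x - y‖ ^ r := by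
          rw [show (2 : ℝ) - r = 1 + (1 - r) by ring, Real.rpow_add hℓ, Real.rpow_one]
          ring
end
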